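/- arXiv:2508.19930 — 3 statements merged into one kernel-verified Lean document; each statement's English description precedes it below -/
import Mathlib

section
/- Let p=(p₁,p₂,p₃) ∈ 𝕊²∖{N} and β = 𝒮(p). Then the center of mass of the translation τ_p satisfies (∫_{𝕊²}𝒥_{τ_p}^{3/2} dω)^{−1} ∫_{𝕊²} ω 𝒥_{τ_p}(ω)^{3/2} dω = (1/(3−p₃))·(−2p₁, −2p₂, 1+p₃) ∈ ℝ³. -/
open MeasureTheory
open scoped Classical

noncomputable section

/-- Squared Euclidean norm on `ℝ²`. -/
def sq2 (x : ℝ × ℝ) : ℝ := x.1 ^ 2 + x.2 ^ 2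

/-- Euclidean dot product on `ℝ³`. -/
def dot3 (a b : Fin 3 → ℝ) : ℝ := a 0 * b 0 + a 1 * b 1 + a 2 * b 2

/-- Squared Euclidean norm on `ℝ³`. -/
def norm3sq (a : Fin 3 → ℝ) : ℝ := dot3 a a

/-- Stereographic projection from the north pole. -/
def SP (ω : Fin 3 → ℝ) : ℝ × ℝ := (ω 0 / (1 - ω 2), ω 1 / (1 - ω 2))

/-- Inverse stereographic projection. -/
def SPinv (x : ℝ × ℝ) : Fin 3 → ℝ :=
  ![2 * x.1 / (1 + sq2 x), 2 * x.2 / (1 + sq2 x), (sq2 x - 1) / (1 + sq2 x)]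

/-- Identification `ℝ² ≅ ℂ`. -/
def cx (x : ℝ × ℝ) : ℂ := ⟨x.1, x.2⟩

/-- Identification `ℂ ≅ ℝ²`. -/
def uncx (z : ℂ) : ℝ × ℝ := (z.re, z.im)

/-- The group `SL(2,ℂ)`. -/
abbrev SL2C := Matrix.SpecialLinearGroup (Fin 2) ℂ

/-- The Möbius transformation associated to `A ∈ SL(2,ℂ)`. -/
def TA (A : SL2C) (z : ℂ) : ℂ := (A.1 0 0 * z + A.1 0 1) / (A.1 1 0 * z + A.1 1 1)

/-- The north pole of `𝕊²`. -/
def northPole : Fin 3 → ℝ := ![0, 0, 1]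

/-- The conformal transformation of `𝕊²` induced by `A ∈ SL(2,ℂ)` via stereographic
projection, extended continuously over the poles. -/
def tauA (A : SL2C) (ω : Fin 3 → ℝ) : Fin 3 → ℝ :=
  if ω 2 = 1 then
    if A.1 1 0 = 0 then northPole else SPinv (uncx (A.1 0 0 / A.1 1 0))
  else if A.1 1 0 * cx (SP ω) + A.1 1 1 = 0 then northPole
  else SPinv (uncx (TA A (cx (SP ω))))

/-- The Jacobian `𝒥_{τ_A}(ω) = ((1+|z|²)/(|az+b|²+|cz+d|²))²`, `z = 𝒮(ω)`,
extended continuously over the north pole. -/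
def jacA (A : SL2C) (ω : Fin 3 → ℝ) : ℝ :=
  if ω 2 = 1 then (1 / (Complex.normSq (A.1 0 0) + Complex.normSq (A.1 1 0))) ^ 2
  else
    ((1 + Complex.normSq (cx (SP ω))) /
        (Complex.normSq (A.1 0 0 * cx (SP ω) + A.1 0 1) +
          Complex.normSq (A.1 1 0 * cx (SP ω) + A.1 1 1))) ^ 2

/-- `∫_{𝕊²} f dω = (1/π) ∫_{ℝ²} f(𝒮⁻¹(x)) (1+|x|²)⁻² dx`, the integral against the
normalized surface measure of `𝕊²`, written in stereographic coordinates. -/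
def sphInt {E : Type*} [NormedAddCommGroup E] [NormedSpace ℝ E]
    (f : (Fin 3 → ℝ) → E) : E :=
  (1 / Real.pi) • ∫ x : ℝ × ℝ, ((1 + sq2 x)⁻¹) ^ 2 • f (SPinv x)

/-- Integrability of `f : 𝕊² → ℝ` with respect to the normalized surface measure,
expressed in stereographic coordinates. -/
def SphIntegrable (f : (Fin 3 → ℝ) → ℝ) : Prop :=
  Integrable fun x : ℝ × ℝ => ((1 + sq2 x)⁻¹) ^ 2 * f (SPinv x)

/-- The mass `M_τ = ∫_{𝕊²} 𝒥_τ^{3/2} dω`. -/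
def massA (A : SL2C) : ℝ := sphInt fun ω => jacA A ω ^ (3 / 2 : ℝ)

/-- The center of mass `a_τ = M_τ⁻¹ ∫_{𝕊²} ω 𝒥_τ^{3/2}(ω) dω`. -/
def comA (A : SL2C) : Fin 3 → ℝ :=
  (massA A)⁻¹ • sphInt fun ω => jacA A ω ^ (3 / 2 : ℝ) • ω

/-- The normalizing constant `c_τ = -(1/2) ln M_τ`. -/
def cA (A : SL2C) : ℝ := -(1 / 2) * Real.log (massA A)

/-- `ψ_τ = (3/4) ln 𝒥_τ + c_τ`. -/
def psiA (A : SL2C) (ω : Fin 3 → ℝ) : ℝ := (3 / 4) * Real.log (jacA A ω) + cA A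

/-- `|∇v(x)|²` for `v : ℝ² → ℝ`. -/
def gradSq (v : ℝ × ℝ → ℝ) (x : ℝ × ℝ) : ℝ :=
  fderiv ℝ v x (1, 0) ^ 2 + fderiv ℝ v x (0, 1) ^ 2

/-- The Dirichlet energy `∫_{𝕊²} |∇_{𝕊²} u|² dω = (1/(4π)) ∫_{ℝ²} |∇(u∘𝒮⁻¹)(x)|² dx`. -/
def gradTerm (u : (Fin 3 → ℝ) → ℝ) : ℝ :=
  (1 / (4 * Real.pi)) * ∫ x : ℝ × ℝ, gradSq (fun y => u (SPinv y)) x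

/-- Membership in the Sobolev space `H¹(𝕊²)`. -/
def MemH1 (u : (Fin 3 → ℝ) → ℝ) : Prop :=
  SphIntegrable u ∧ SphIntegrable (fun ω => u ω ^ 2) ∧
    Integrable fun x : ℝ × ℝ => gradSq (fun y => u (SPinv y)) x

/-- The Chang–Gui functional `I_α`. -/
def CG (α : ℝ) (u : (Fin 3 → ℝ) → ℝ) : ℝ :=
  α * gradTerm u + 2 * sphInt u -
    (1 / 2) * Real.log
      ((sphInt fun ω => Real.exp (2 * u ω)) ^ 2 -
        norm3sq (sphInt fun ω => Real.exp (2 * u ω) • ω))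

end

/-- Jacobian of the translation by `β` (given by `x ↦ x + β` in stereographic
coordinates). -/
noncomputable def jacTr (β : ℝ × ℝ) (ω : Fin 3 → ℝ) : ℝ :=
  ((1 + sq2 (SP ω)) / (1 + sq2 (SP ω + β))) ^ 2

lemma aux_K_pos (x : ℝ × ℝ) : 0 < 1 + sq2 x := by unfold sq2; positivity

lemma aux_cont : Continuous fun x : ℝ × ℝ => 1 + sq2 x := by unfold sq2; fun_prop

lemma aux_radial (n : ℕ) :
    ∫ r in Set.Ioi (0 : ℝ), r * ((1 + r ^ 2)⁻¹) ^ (n + 2) = 1 / (2 * (n + 1)) := by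
  have hn : (0 : ℝ) < n + 1 := by positivity
  have hd : ∀ x ∈ Set.Ici (0 : ℝ), HasDerivAt
      (fun r : ℝ => -(1 / (2 * ((n : ℝ) + 1))) * ((1 + r ^ 2)⁻¹) ^ (n + 1))
      (x * ((1 + x ^ 2)⁻¹) ^ (n + 2)) x := by
    intro x _
    have hx : (1 + x ^ 2 : ℝ) ≠ 0 := by positivity
    have h1 : HasDerivAt (fun r : ℝ => 1 + r ^ 2) (2 * x) x := by
      simpa using (hasDerivAt_pow 2 x).const_add 1
    have h2 := ((h1.inv hx).pow (n + 1)).const_mul (-(1 / (2 * ((n : ℝ) + 1))))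
    refine h2.congr_deriv ?_
    simp only [Pi.inv_apply, Nat.add_sub_cancel]
    push_cast
    simp only [inv_pow]
    field_simp
    ring
  have ht : Filter.Tendsto
      (fun r : ℝ => -(1 / (2 * ((n : ℝ) + 1))) * ((1 + r ^ 2)⁻¹) ^ (n + 1))
      Filter.atTop (nhds 0) := by
    have h1 : Filter.Tendsto (fun r : ℝ => (1 + r ^ 2)⁻¹) Filter.atTop (nhds 0) :=
      Filter.Tendsto.inv_tendsto_atTop
        (Filter.tendsto_atTop_add_const_left _ _ (Filter.tendsto_pow_atTop two_ne_zero))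
    simpa using (h1.pow (n + 1)).const_mul (-(1 / (2 * ((n : ℝ) + 1))))
  rw [integral_Ioi_of_hasDerivAt_of_nonneg' hd ?_ ht]
  · simp
  · intro x hx
    have : 0 < x := hx
    positivity

lemma aux_plane (n : ℕ) :
    ∫ x : ℝ × ℝ, ((1 + sq2 x)⁻¹) ^ (n + 2) = Real.pi / (n + 1) := by
  rw [← integral_comp_polarCoord_symm]
  have h : ∀ p : ℝ × ℝ, p.1 • ((1 + sq2 (polarCoord.symm p))⁻¹) ^ (n + 2)
      = (p.1 * ((1 + p.1 ^ 2)⁻¹) ^ (n + 2)) * (fun _ : ℝ => (1 : ℝ)) p.2 := by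
    intro p
    have : sq2 (polarCoord.symm p) = p.1 ^ 2 := by
      simp only [sq2, polarCoord_symm_apply]
      linear_combination p.1 ^ 2 * Real.sin_sq_add_cos_sq p.2
    rw [this]; simp
  rw [funext h, polarCoord_target, Measure.volume_eq_prod,
    setIntegral_prod_mul (fun r : ℝ => r * ((1 + r ^ 2)⁻¹) ^ (n + 2)) (fun _ : ℝ => (1 : ℝ)), aux_radial]
  have hn : (0 : ℝ) < n + 1 := by positivity
  simp [Real.pi_pos.le]
  field_simp
  try norm_num

lemma aux_int (n : ℕ) :
    Integrable fun x : ℝ × ℝ => ((1 + sq2 x)⁻¹) ^ (n + 2) := by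
  by_contra h
  have h1 := aux_plane n
  rw [integral_undef h] at h1
  have : 0 < Real.pi / ((n : ℝ) + 1) := by have := Real.pi_pos; positivity
  linarith

lemma aux_odd_int (a b : ℝ) :
    Integrable fun x : ℝ × ℝ => (a * x.1 + b * x.2) * ((1 + sq2 x)⁻¹) ^ 3 := by
  refine ((aux_int 0).const_mul (|a| + |b|)).mono' ?_ ?_
  · refine Continuous.aestronglyMeasurable ?_
    exact (by fun_prop : Continuous fun x : ℝ × ℝ => a * x.1 + b * x.2).mul
      ((aux_cont.inv₀ fun x => (aux_K_pos x).ne').pow 3)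
  · refine Filter.Eventually.of_forall fun x => ?_
    have hK := aux_K_pos x
    have h1 : |x.1| ≤ 1 + sq2 x := by
      unfold sq2; nlinarith [sq_abs x.1, sq_nonneg (|x.1| - 1), sq_nonneg x.2, abs_nonneg x.1]
    have h2 : |x.2| ≤ 1 + sq2 x := by
      unfold sq2; nlinarith [sq_abs x.2, sq_nonneg (|x.2| - 1), sq_nonneg x.1, abs_nonneg x.2]
    have h3 : |a * x.1 + b * x.2| ≤ (|a| + |b|) * (1 + sq2 x) := by
      refine (abs_add_le _ _).trans ?_
      rw [abs_mul, abs_mul, add_mul]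
      gcongr
    rw [Real.norm_eq_abs, abs_mul, abs_of_pos (by positivity : 0 < ((1 + sq2 x)⁻¹) ^ 3)]
    calc _ ≤ (|a| + |b|) * (1 + sq2 x) * ((1 + sq2 x)⁻¹) ^ 3 := by gcongr
      _ = _ := by simp only [inv_pow, zero_add]; field_simp

lemma aux_odd (a b : ℝ) :
    ∫ x : ℝ × ℝ, (a * x.1 + b * x.2) * ((1 + sq2 x)⁻¹) ^ 3 = 0 := by
  have h := integral_neg_eq_self
    (fun x : ℝ × ℝ => (a * x.1 + b * x.2) * ((1 + sq2 x)⁻¹) ^ 3) volume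
  have h2 : ∀ x : ℝ × ℝ, (a * (-x).1 + b * (-x).2) * ((1 + sq2 (-x))⁻¹) ^ 3
      = -((a * x.1 + b * x.2) * ((1 + sq2 x)⁻¹) ^ 3) := by
    intro x; simp [sq2]; ring
  simp_rw [h2, integral_neg] at h
  linarith

lemma aux_main (β : ℝ × ℝ) (a b c d : ℝ) (G : ℝ × ℝ → ℝ)
    (hG : ∀ x, G x = (a * (x + β).1 + b * (x + β).2) * ((1 + sq2 (x + β))⁻¹) ^ 3
      + c * ((1 + sq2 (x + β))⁻¹) ^ 3 + d * ((1 + sq2 (x + β))⁻¹) ^ 2) :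
    Integrable G ∧ ∫ x, G x = (c / 2 + d) * Real.pi := by
  set F : ℝ × ℝ → ℝ := fun x => (a * x.1 + b * x.2) * ((1 + sq2 x)⁻¹) ^ 3
      + c * ((1 + sq2 x)⁻¹) ^ 3 + d * ((1 + sq2 x)⁻¹) ^ 2 with hF
  have i1 := aux_odd_int a b
  have i2 := (aux_int 1).const_mul c
  have i3 := (aux_int 0).const_mul d
  have hi : Integrable F := (i1.add i2).add i3
  have hv : ∫ x, F x = (c / 2 + d) * Real.pi := by
    have e : ∫ x, F x = _ := integral_add (i1.add i2) i3
    have e1 : ∫ x : ℝ × ℝ, ((a * x.1 + b * x.2) * ((1 + sq2 x)⁻¹) ^ 3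
        + c * ((1 + sq2 x)⁻¹) ^ 3) = _ := integral_add i1 i2
    have p1 : ∫ x : ℝ × ℝ, ((1 + sq2 x)⁻¹) ^ 3 = _ := aux_plane 1
    have p0 : ∫ x : ℝ × ℝ, ((1 + sq2 x)⁻¹) ^ 2 = _ := aux_plane 0
    rw [e, e1, aux_odd, integral_const_mul, integral_const_mul, p1, p0]
    push_cast
    ring
  have hGF : G = fun x => F (x + β) := funext hG
  rw [hGF]
  exact ⟨hi.comp_add_right β, by rw [integral_add_right_eq_self F β, hv]⟩

lemma aux_SP (x : ℝ × ℝ) : SP (SPinv x) = x := by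
  have hK := (aux_K_pos x).ne'
  have h : 1 - (sq2 x - 1) / (1 + sq2 x) = 2 / (1 + sq2 x) := by field_simp; ring
  ext <;> simp [SP, SPinv, h] <;> field_simp

lemma aux_jac (β x : ℝ × ℝ) :
    jacTr β (SPinv x) ^ (3 / 2 : ℝ) = ((1 + sq2 x) * (1 + sq2 (x + β))⁻¹) ^ 3 := by
  have h1 := aux_K_pos x
  have h2 := aux_K_pos (x + β)
  rw [jacTr, aux_SP, ← div_eq_mul_inv, ← Real.rpow_natCast, ← Real.rpow_mul (by positivity),
    ← Real.rpow_natCast]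
  norm_num

/-- the center of mass of the translation `τ_p` equals
`(1/(3−p₃))·(−2p₁, −2p₂, 1+p₃)`. -/
theorem com_translation (p : Fin 3 → ℝ) (hp : norm3sq p = 1) (hN : p 2 ≠ 1) :
    (sphInt fun ω => jacTr (SP p) ω ^ (3 / 2 : ℝ))⁻¹ •
        (sphInt fun ω => jacTr (SP p) ω ^ (3 / 2 : ℝ) • ω)
      = (3 - p 2)⁻¹ • ![-2 * p 0, -2 * p 1, 1 + p 2]
    := by
  set β := SP p with hβ
  have hM : (sphInt fun ω => jacTr β ω ^ (3 / 2 : ℝ)) = 1 + sq2 β / 2 := by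
    have h := (aux_main β (-2 * β.1) (-2 * β.2) (sq2 β) 1
      (fun x => ((1 + sq2 x)⁻¹) ^ 2 • jacTr β (SPinv x) ^ (3 / 2 : ℝ)) (fun x => by
        have h1 := (aux_K_pos x).ne'
        have h2 := (aux_K_pos (x + β)).ne'
        simp only [aux_jac, smul_eq_mul]
        field_simp
        simp only [sq2, Prod.fst_add, Prod.snd_add]
        ring)).2
    have := Real.pi_pos.ne'
    rw [sphInt, h, smul_eq_mul]
    field_simp
    ring
  have c0 := aux_main β 2 0 (-2 * β.1) 0
      (fun x => (((1 + sq2 x)⁻¹) ^ 2 • jacTr β (SPinv x) ^ (3 / 2 : ℝ) • SPinv x) 0)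
      (fun x => by
        have h1 := (aux_K_pos x).ne'
        have h2 := (aux_K_pos (x + β)).ne'
        simp only [aux_jac, smul_eq_mul, Pi.smul_apply]
        simp only [SPinv, Matrix.cons_val]
        field_simp
        simp only [sq2, Prod.fst_add, Prod.snd_add]
        ring)
  have c1 := aux_main β 0 2 (-2 * β.2) 0
      (fun x => (((1 + sq2 x)⁻¹) ^ 2 • jacTr β (SPinv x) ^ (3 / 2 : ℝ) • SPinv x) 1)
      (fun x => by
        have h1 := (aux_K_pos x).ne'
        have h2 := (aux_K_pos (x + β)).ne'
        simp only [aux_jac, smul_eq_mul, Pi.smul_apply]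
        simp only [SPinv, Matrix.cons_val]
        field_simp
        simp only [sq2, Prod.fst_add, Prod.snd_add]
        ring)
  have c2 := aux_main β (-2 * β.1) (-2 * β.2) (sq2 β - 2) 1
      (fun x => (((1 + sq2 x)⁻¹) ^ 2 • jacTr β (SPinv x) ^ (3 / 2 : ℝ) • SPinv x) 2)
      (fun x => by
        have h1 := (aux_K_pos x).ne'
        have h2 := (aux_K_pos (x + β)).ne'
        simp only [aux_jac, smul_eq_mul, Pi.smul_apply]
        simp only [SPinv, Matrix.cons_val]
        field_simp
        simp only [sq2, Prod.fst_add, Prod.snd_add]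
        ring)
  have hint : ∀ i, Integrable (fun x : ℝ × ℝ =>
      (((1 + sq2 x)⁻¹) ^ 2 • jacTr β (SPinv x) ^ (3 / 2 : ℝ) • SPinv x) i) := by
    intro i
    fin_cases i
    exacts [c0.1, c1.1, c2.1]
  have hpi := Real.pi_pos.ne'
  have hN' : 1 - p 2 ≠ 0 := fun h => hN (by linarith)
  have hp' : p 0 * p 0 + p 1 * p 1 + p 2 * p 2 = 1 := hp
  have h3 : 3 - p 2 ≠ 0 := by nlinarith [mul_self_nonneg (p 0), mul_self_nonneg (p 1)]
  have hs : sq2 β = (1 + p 2) / (1 - p 2) := by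
    simp only [hβ, sq2, SP]
    field_simp
    linear_combination hp'
  have hM' : (1 + sq2 β / 2)⁻¹ = 2 * (1 - p 2) / (3 - p 2) := by
    have : 1 + sq2 β / 2 = (3 - p 2) / (2 * (1 - p 2)) := by rw [hs]; field_simp; ring
    rw [this, inv_div]
  have b0 : β.1 = p 0 / (1 - p 2) := rfl
  have b1 : β.2 = p 1 / (1 - p 2) := rfl
  rw [hM, hM']
  funext i
  rw [sphInt, Pi.smul_apply, Pi.smul_apply, eval_integral hint i]
  fin_cases i
  · have := c0.2
    simp only [Fin.zero_eta, Fin.mk_one, Fin.reduceFinMk] at this ⊢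
    rw [this, b0]
    simp only [smul_eq_mul, Pi.smul_apply, Matrix.cons_val]
    field_simp
    try ring
  · have := c1.2
    simp only [Fin.zero_eta, Fin.mk_one, Fin.reduceFinMk] at this ⊢
    rw [this, b1]
    simp only [smul_eq_mul, Pi.smul_apply, Matrix.cons_val]
    field_simp
    try ring
  · have := c2.2
    simp only [Fin.zero_eta, Fin.mk_one, Fin.reduceFinMk] at this ⊢
    rw [this, hs]
    simp only [smul_eq_mul, Pi.smul_apply, Matrix.cons_val]
    field_simp
    try ring
end

section
/- For every conformal transformation τ of 𝕊² with center of mass a = a_τ and mass M_τ, and for every ω ∈ 𝕊², the pointwise identity 𝒥_τ(ω)^{1/2} = ((1 − |a|²)/(1 − a·ω)) · M_τ holds, where a·ω denotes the Euclidean inner product in ℝ³. -/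
open MeasureTheory
open scoped Classical

section helpers

lemma sq2_nonneg' (x : ℝ × ℝ) : 0 ≤ sq2 x := by unfold sq2; positivity

lemma sq2_continuous : Continuous sq2 := by unfold sq2; fun_prop

lemma base_integrable : Integrable (fun x : ℝ × ℝ => ((1 + sq2 x) ^ 2)⁻¹) := by
  have h := integrable_rpow_neg_one_add_norm_sq (E := ℝ × ℝ) (μ := volume) (r := 4)
    (by simp; norm_num)
  refine h.mono' ?_ ?_
  · apply Continuous.aestronglyMeasurable
    have := sq2_continuous
    refine Continuous.inv₀ (by fun_prop) (fun x => ?_)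
    have := sq2_nonneg' x
    positivity
  · filter_upwards with x
    have h0 := sq2_nonneg' x
    have h1 : ‖x‖ ^ 2 ≤ sq2 x := by
      unfold sq2
      rw [Prod.norm_def]
      rcases max_choice ‖x.1‖ ‖x.2‖ with h | h <;> rw [h] <;>
        simp only [Real.norm_eq_abs, sq_abs] <;> nlinarith [sq_nonneg x.1, sq_nonneg x.2]
    have e : (-4 / 2 : ℝ) = -((2 : ℕ) : ℝ) := by norm_num
    rw [e, Real.rpow_neg (by positivity), Real.rpow_natCast, Real.norm_of_nonneg (by positivity)]
    gcongr

lemma base_dom (n : ℝ × ℝ → ℝ) (hn : Continuous n) (hb : ∀ x, |n x| ≤ 1 + sq2 x) :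
    Integrable (fun x : ℝ × ℝ => n x * ((1 + sq2 x) ^ 3)⁻¹) := by
  refine base_integrable.mono' ?_ ?_
  · apply Continuous.aestronglyMeasurable
    have := sq2_continuous
    refine hn.mul (Continuous.inv₀ (by fun_prop) (fun x => ?_))
    have := sq2_nonneg' x
    positivity
  · filter_upwards with x
    have h0 := sq2_nonneg' x
    have h1 : 0 < 1 + sq2 x := by positivity
    rw [norm_mul, Real.norm_eq_abs, Real.norm_of_nonneg (by positivity)]
    calc |n x| * ((1 + sq2 x) ^ 3)⁻¹ ≤ (1 + sq2 x) * ((1 + sq2 x) ^ 3)⁻¹ := by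
          gcongr; exact hb x
      _ = _ := by field_simp

lemma radial (k : ℕ) : ∫ r in Set.Ioi (0:ℝ), r * ((1 + r ^ 2) ^ (k + 2))⁻¹
    = 1 / (2 * (k + 1)) := by
  have h := integral_Ioi_of_hasDerivAt_of_nonneg'
    (g := fun r : ℝ => -(1 / (2 * (k + 1))) * ((1 + r ^ 2) ^ (k + 1))⁻¹)
    (g' := fun r : ℝ => r * ((1 + r ^ 2) ^ (k + 2))⁻¹) (a := 0) (l := 0) ?_ ?_ ?_
  · rw [h]; simp
  · intro x _
    have h1 : HasDerivAt (fun r : ℝ => (1 + r ^ 2) ^ (k + 1))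
        (((k + 1 : ℕ) : ℝ) * (1 + x ^ 2) ^ k * (2 * x)) x := by
      have := ((hasDerivAt_pow 2 x).const_add 1).pow (k + 1)
      simp at this ⊢
      exact this
    have hp : (0:ℝ) < 1 + x ^ 2 := by positivity
    have h2 := (h1.inv (by positivity)).const_mul (-(1 / (2 * ((k:ℝ) + 1))))
    refine h2.congr_deriv ?_
    push_cast
    field_simp
    try ring
  · intro x hx
    have : (0:ℝ) < x := hx
    positivity
  · have h1 : Filter.Tendsto (fun r : ℝ => (1 + r ^ 2) ^ (k + 1)) Filter.atTop Filter.atTop := by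
      refine (Filter.tendsto_pow_atTop (by omega)).comp ?_
      exact Filter.tendsto_atTop_add_const_left _ _ (Filter.tendsto_pow_atTop (by omega))
    simpa using h1.inv_tendsto_atTop.const_mul (-(1 / (2 * ((k:ℝ) + 1))))

lemma planar (k : ℕ) : ∫ x : ℝ × ℝ, ((1 + sq2 x) ^ (k + 2))⁻¹ = Real.pi / (k + 1) := by
  rw [← integral_comp_polarCoord_symm]
  have e : ∀ p : ℝ × ℝ, p.1 • ((1 + sq2 (polarCoord.symm p)) ^ (k + 2))⁻¹
      = (p.1 * ((1 + p.1 ^ 2) ^ (k + 2))⁻¹) * (1:ℝ) := by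
    intro p
    have : sq2 (polarCoord.symm p) = p.1 ^ 2 := by
      simp only [sq2, polarCoord_symm_apply]
      linear_combination p.1 ^ 2 * Real.sin_sq_add_cos_sq p.2
    rw [this]; simp
  simp_rw [e]
  rw [polarCoord_target, Measure.volume_eq_prod,
    setIntegral_prod_mul (fun r : ℝ => r * ((1 + r ^ 2) ^ (k + 2))⁻¹) (fun _ => (1:ℝ)), radial]
  have : (-Real.pi) ≤ Real.pi := by linarith [Real.pi_pos]
  simp [Real.pi_pos.le]
  field_simp
  ring

lemma odd_zero (n : ℝ × ℝ → ℝ) (hn : ∀ x, n (-x) = - n x) :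
    ∫ x : ℝ × ℝ, n x * ((1 + sq2 x) ^ 3)⁻¹ = 0 := by
  have h := integral_neg_eq_self (fun x : ℝ × ℝ => n x * ((1 + sq2 x) ^ 3)⁻¹) volume
  have e : ∀ x, n (-x) * ((1 + sq2 (-x)) ^ 3)⁻¹ = -(n x * ((1 + sq2 x) ^ 3)⁻¹) := by
    intro x
    rw [hn]; simp [sq2]
  simp_rw [e] at h
  rw [integral_neg] at h
  linarith

lemma std_int (c0 c1 c2 c3 : ℝ) :
    Integrable (fun x : ℝ × ℝ => (c0 + c1 * x.1 + c2 * x.2 + c3 * sq2 x) * ((1 + sq2 x) ^ 3)⁻¹) ∧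
    ∫ x : ℝ × ℝ, (c0 + c1 * x.1 + c2 * x.2 + c3 * sq2 x) * ((1 + sq2 x) ^ 3)⁻¹
      = Real.pi / 2 * (c0 + c3) := by
  have i0 := (base_dom (fun _ => 1) (by fun_prop) (fun x => by
    have := sq2_nonneg' x
    simp [this])).const_mul (c0 - c3)
  have i1 := (base_dom (fun x => x.1) (by fun_prop) (fun x => by
    simp only [sq2]; rw [abs_le]
    constructor <;> nlinarith [sq_nonneg (x.1 - 1), sq_nonneg (x.1 + 1), sq_nonneg x.2])).const_mul c1
  have i2 := (base_dom (fun x => x.2) (by fun_prop) (fun x => by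
    simp only [sq2]; rw [abs_le]
    constructor <;> nlinarith [sq_nonneg (x.2 - 1), sq_nonneg (x.2 + 1), sq_nonneg x.1])).const_mul c2
  have i3 := base_integrable.const_mul c3
  have v0 := planar 1
  have v1 := odd_zero (fun x => x.1) (fun x => rfl)
  have v2 := odd_zero (fun x => x.2) (fun x => rfl)
  have v3 := planar 0
  have e : (fun x : ℝ × ℝ => (c0 + c1 * x.1 + c2 * x.2 + c3 * sq2 x) * ((1 + sq2 x) ^ 3)⁻¹)
      = fun x => (((c0 - c3) * (1 * ((1 + sq2 x) ^ 3)⁻¹) + c1 * (x.1 * ((1 + sq2 x) ^ 3)⁻¹))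
        + c2 * (x.2 * ((1 + sq2 x) ^ 3)⁻¹)) + c3 * ((1 + sq2 x) ^ 2)⁻¹ := by
    funext x
    have h0 := sq2_nonneg' x
    have h1 : 0 < 1 + sq2 x := by positivity
    field_simp
    ring
  rw [e]
  refine ⟨((i0.add i1).add i2).add i3, ?_⟩
  have j1 : Integrable (fun x : ℝ × ℝ => (c0 - c3) * (1 * ((1 + sq2 x) ^ 3)⁻¹) +
      c1 * (x.1 * ((1 + sq2 x) ^ 3)⁻¹)) := i0.add i1
  have j2 : Integrable (fun x : ℝ × ℝ => (c0 - c3) * (1 * ((1 + sq2 x) ^ 3)⁻¹) +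
      c1 * (x.1 * ((1 + sq2 x) ^ 3)⁻¹) + c2 * (x.2 * ((1 + sq2 x) ^ 3)⁻¹)) := j1.add i2
  rw [integral_add j2 i3, integral_add j1 i2, integral_add i0 i1]
  simp only [integral_const_mul, one_mul]
  rw [v1, v2]
  norm_num at v0 v3
  rw [v0, v3]
  ring

/-- The main integral. -/
lemma quad_int (p q1 q2 r : ℝ) (hp : 0 < p) (hd : p * r - q1 ^ 2 - q2 ^ 2 = 1)
    (c0 c1 c2 c3 : ℝ) :
    Integrable (fun x : ℝ × ℝ => (c0 + c1 * x.1 + c2 * x.2 + c3 * sq2 x) *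
      ((p * sq2 x + 2 * q1 * x.1 + 2 * q2 * x.2 + r) ^ 3)⁻¹) ∧
    ∫ x : ℝ × ℝ, (c0 + c1 * x.1 + c2 * x.2 + c3 * sq2 x) *
      ((p * sq2 x + 2 * q1 * x.1 + 2 * q2 * x.2 + r) ^ 3)⁻¹
      = Real.pi / 2 * (c0 * p - c1 * q1 - c2 * q2 + c3 * r) := by
  set F := fun x : ℝ × ℝ => (c0 + c1 * x.1 + c2 * x.2 + c3 * sq2 x) *
      ((p * sq2 x + 2 * q1 * x.1 + 2 * q2 * x.2 + r) ^ 3)⁻¹ with hF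
  set m : ℝ × ℝ := (-q1 / p, -q2 / p) with hm
  have hr : r = (1 + q1 ^ 2 + q2 ^ 2) / p := by field_simp; linarith
  obtain ⟨hi, hv⟩ := std_int
    (p ^ 3 * (c0 - c1 * (q1 / p) - c2 * (q2 / p) + c3 * ((q1 ^ 2 + q2 ^ 2) / p ^ 2)))
    (p ^ 3 * (c1 / p - 2 * c3 * q1 / p ^ 2)) (p ^ 3 * (c2 / p - 2 * c3 * q2 / p ^ 2))
    (p ^ 3 * (c3 / p ^ 2))
  have e : (fun u : ℝ × ℝ => F (p⁻¹ • u + m)) = fun x : ℝ × ℝ =>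
    ((p ^ 3 * (c0 - c1 * (q1 / p) - c2 * (q2 / p) + c3 * ((q1 ^ 2 + q2 ^ 2) / p ^ 2))) +
    (p ^ 3 * (c1 / p - 2 * c3 * q1 / p ^ 2)) * x.1 + (p ^ 3 * (c2 / p - 2 * c3 * q2 / p ^ 2)) * x.2
    + (p ^ 3 * (c3 / p ^ 2)) * sq2 x) * ((1 + sq2 x) ^ 3)⁻¹ := by
    funext u
    have h0 := sq2_nonneg' u
    have h1 : 0 < 1 + sq2 u := by positivity
    have hQ : p * sq2 (p⁻¹ • u + m) + 2 * q1 * (p⁻¹ • u + m).1 + 2 * q2 * (p⁻¹ • u + m).2 + r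
        = (1 + sq2 u) / p := by
      rw [hr]
      simp only [sq2, hm, Prod.fst_add, Prod.snd_add, Prod.smul_fst, Prod.smul_snd, smul_eq_mul]
      field_simp
      ring
    simp only [hF]
    rw [hQ, div_pow, inv_div, div_eq_mul_inv, ← mul_assoc]
    congr 1
    simp only [sq2, hm, Prod.fst_add, Prod.snd_add, Prod.smul_fst, Prod.smul_snd, smul_eq_mul]
    field_simp
    ring
  rw [← e] at hi hv
  have hp' : p⁻¹ ≠ 0 := by positivity
  constructor
  · have h2 : Integrable (fun u : ℝ × ℝ => F (u + m)) :=
      (integrable_comp_smul_iff volume (fun u : ℝ × ℝ => F (u + m)) hp').1 hi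
    have h3 := h2.comp_sub_right m
    simpa using h3
  · have h2 := Measure.integral_comp_smul volume (fun u : ℝ × ℝ => F (u + m)) p⁻¹
    rw [hv, integral_add_right_eq_self F m] at h2
    simp only [Module.finrank_prod, Module.finrank_self, smul_eq_mul] at h2
    rw [abs_of_pos (by positivity)] at h2
    have : ∫ x, F x = (p ^ 2)⁻¹ * (((p⁻¹ ^ (1 + 1))⁻¹) * ∫ x, F x) := by
      rw [← mul_assoc]
      have : (p ^ 2)⁻¹ * (p⁻¹ ^ (1 + 1))⁻¹ = 1 := by norm_num; field_simp
      rw [this, one_mul]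
    rw [this, ← h2, hr]
    field_simp
    ring

end helpers

section main

lemma sqrtJ (A : SL2C) : ∃ p q1 q2 r : ℝ, 0 < p ∧ p * r - q1 ^ 2 - q2 ^ 2 = 1 ∧
    p = Complex.normSq (A.1 0 0) + Complex.normSq (A.1 1 0) ∧
    ∀ x : ℝ × ℝ, Complex.normSq (A.1 0 0 * cx x + A.1 0 1) +
          Complex.normSq (A.1 1 0 * cx x + A.1 1 1)
          = p * sq2 x + 2 * q1 * x.1 + 2 * q2 * x.2 + r := by
  have hdet := A.2
  rw [Matrix.det_fin_two] at hdet
  generalize A.1 0 0 = a at *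
  generalize A.1 0 1 = b at *
  generalize A.1 1 0 = c at *
  generalize A.1 1 1 = d at *
  have h1 := congrArg Complex.re hdet
  have h2 := congrArg Complex.im hdet
  simp at h1 h2
  refine ⟨_, a.re * b.re + a.im * b.im + c.re * d.re + c.im * d.im,
    a.re * b.im - a.im * b.re + c.re * d.im - c.im * d.re,
    Complex.normSq b + Complex.normSq d, ?_, ?_, rfl, ?_⟩
  · by_contra h
    have ha := Complex.normSq_nonneg a
    have hc := Complex.normSq_nonneg c
    have ha : a = 0 := Complex.normSq_eq_zero.1 (by linarith)
    have hc : c = 0 := Complex.normSq_eq_zero.1 (by linarith)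
    simp [ha, hc] at hdet
  · simp only [Complex.normSq_apply]
    linear_combination (a.re * d.re - a.im * d.im - (b.re * c.re - b.im * c.im) + 1) * h1 +
      (a.re * d.im + a.im * d.re - (b.re * c.im + b.im * c.re)) * h2
  · intro x
    simp [Complex.normSq_apply, sq2, cx]
    ring

/-- the pointwise identity
`𝒥_τ(ω)^{1/2} = ((1 − |a_τ|²)/(1 − a_τ·ω)) · M_τ`. -/
theorem jac_half_identity (A : SL2C) (ω : Fin 3 → ℝ) (hω : norm3sq ω = 1) :
    Real.sqrt (jacA A ω)
      = ((1 - norm3sq (comA A)) / (1 - dot3 (comA A) ω)) * massA A := by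
  obtain ⟨p, q1, q2, r, hp, hd, hpe, hQ⟩ := sqrtJ A
  have hQpos : ∀ x : ℝ × ℝ, 0 < p * sq2 x + 2 * q1 * x.1 + 2 * q2 * x.2 + r := by
    intro x
    have : p * (p * sq2 x + 2 * q1 * x.1 + 2 * q2 * x.2 + r)
      = (p * x.1 + q1) ^ 2 + (p * x.2 + q2) ^ 2 + 1 := by
      simp only [sq2]; linear_combination hd
    have h2 : 0 < p * (p * sq2 x + 2 * q1 * x.1 + 2 * q2 * x.2 + r) := by rw [this]; positivity
    exact pos_of_mul_pos_right h2 hp.le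
  have hr : 0 < r := by simpa [sq2] using hQpos 0
  have hcx : ∀ x : ℝ × ℝ, Complex.normSq (cx x) = sq2 x := by
    intro x; simp [Complex.normSq_apply, cx, sq2]; ring
  have hJ : ∀ x : ℝ × ℝ, jacA A (SPinv x) =
      ((1 + sq2 x) / (p * sq2 x + 2 * q1 * x.1 + 2 * q2 * x.2 + r)) ^ 2 := by
    intro x
    have h0 := sq2_nonneg' x
    have h1 : 0 < 1 + sq2 x := by positivity
    have h2 : SPinv x 2 ≠ 1 := by
      simp only [SPinv, Matrix.cons_val]
      intro h
      rw [div_eq_one_iff_eq h1.ne'] at h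
      linarith
    have h3 : SP (SPinv x) = x := by
      have : 1 - (sq2 x - 1) / (1 + sq2 x) = 2 / (1 + sq2 x) := by field_simp; ring
      ext <;> simp only [SP, SPinv, Matrix.cons_val, Matrix.cons_val_zero, Matrix.cons_val_one] <;>
        rw [this] <;> field_simp
    rw [jacA, if_neg h2, h3, hcx, hQ]
  have hJ3 : ∀ x : ℝ × ℝ, ((1 + sq2 x)⁻¹) ^ 2 * jacA A (SPinv x) ^ (3 / 2 : ℝ) =
      (1 + sq2 x) * ((p * sq2 x + 2 * q1 * x.1 + 2 * q2 * x.2 + r) ^ 3)⁻¹ := by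
    intro x
    have h0 := sq2_nonneg' x
    have h1 : 0 < 1 + sq2 x := by positivity
    have h2 := hQpos x
    have h3 : (0:ℝ) < (1 + sq2 x) / (p * sq2 x + 2 * q1 * x.1 + 2 * q2 * x.2 + r) := by positivity
    rw [hJ, ← Real.rpow_natCast (_ / _) 2, ← Real.rpow_mul h3.le]
    have : ((2:ℕ):ℝ) * (3 / 2) = ((3:ℕ):ℝ) := by norm_num
    rw [this, Real.rpow_natCast]
    field_simp
  have hM : massA A = (p + r) / 2 := by
    have := (quad_int p q1 q2 r hp hd 1 0 0 1).2
    simp only [massA, sphInt, smul_eq_mul, hJ3]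
    have e : ∀ x : ℝ × ℝ, 1 + 0 * x.1 + 0 * x.2 + 1 * sq2 x = 1 + sq2 x := fun x => by ring
    simp only [e] at this
    rw [this]
    field_simp
    ring
  have hS : ∀ (i : Fin 3) (c0 c1 c2 c3 : ℝ),
      (∀ x, (1 + sq2 x) * SPinv x i = c0 + c1 * x.1 + c2 * x.2 + c3 * sq2 x) →
      Integrable (fun x : ℝ × ℝ => (((1 + sq2 x)⁻¹) ^ 2 • (jacA A (SPinv x) ^ (3 / 2 : ℝ) • SPinv x)) i) ∧
      ∫ x : ℝ × ℝ, (((1 + sq2 x)⁻¹) ^ 2 • (jacA A (SPinv x) ^ (3 / 2 : ℝ) • SPinv x)) i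
        = Real.pi / 2 * (c0 * p - c1 * q1 - c2 * q2 + c3 * r) := by
    intro i c0 c1 c2 c3 h
    have e : ∀ x : ℝ × ℝ, (((1 + sq2 x)⁻¹) ^ 2 • (jacA A (SPinv x) ^ (3 / 2 : ℝ) • SPinv x)) i
        = (c0 + c1 * x.1 + c2 * x.2 + c3 * sq2 x) *
      ((p * sq2 x + 2 * q1 * x.1 + 2 * q2 * x.2 + r) ^ 3)⁻¹ := by
      intro x
      rw [← h, Pi.smul_apply, Pi.smul_apply, smul_eq_mul, smul_eq_mul, ← mul_assoc, hJ3]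
      ring
    simp only [e]
    exact quad_int p q1 q2 r hp hd c0 c1 c2 c3
  have s0 := hS 0 0 2 0 0 (fun x => by
    have h0 := sq2_nonneg' x
    have h1 : 0 < 1 + sq2 x := by positivity
    simp only [SPinv, Matrix.cons_val_zero]; field_simp; ring)
  have s1 := hS 1 0 0 2 0 (fun x => by
    have h0 := sq2_nonneg' x
    have h1 : 0 < 1 + sq2 x := by positivity
    simp only [SPinv, Matrix.cons_val_one, Matrix.cons_val_zero]; field_simp; ring)
  have s2 := hS 2 (-1) 0 0 1 (fun x => by
    have h0 := sq2_nonneg' x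
    have h1 : 0 < 1 + sq2 x := by positivity
    simp only [SPinv, Matrix.cons_val]; field_simp; ring)
  have hint : ∀ i : Fin 3, Integrable (fun x : ℝ × ℝ =>
      (((1 + sq2 x)⁻¹) ^ 2 • (jacA A (SPinv x) ^ (3 / 2 : ℝ) • SPinv x)) i) := by
    intro i
    fin_cases i
    · exact s0.1
    · exact s1.1
    · exact s2.1
  have hcom : ∀ i, comA A i = ((p + r) / 2)⁻¹ * (1 / Real.pi * ∫ x : ℝ × ℝ,
      (((1 + sq2 x)⁻¹) ^ 2 • (jacA A (SPinv x) ^ (3 / 2 : ℝ) • SPinv x)) i) := by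
    intro i
    rw [comA, hM, sphInt, Pi.smul_apply, Pi.smul_apply, eval_integral hint, smul_eq_mul, smul_eq_mul]
  have a0 : comA A 0 = - 2 * q1 / (p + r) := by
    rw [hcom, s0.2]; field_simp; ring
  have a1 : comA A 1 = - 2 * q2 / (p + r) := by
    rw [hcom, s1.2]; field_simp; ring
  have a2 : comA A 2 = (r - p) / (p + r) := by
    rw [hcom, s2.2]; field_simp; ring
  have hn : 1 - norm3sq (comA A) = 4 / (p + r) ^ 2 := by
    rw [norm3sq, dot3, a0, a1, a2]
    field_simp
    linear_combination 4 * hd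
  have hdot : 1 - dot3 (comA A) ω
      = ((p + r) + 2 * q1 * ω 0 + 2 * q2 * ω 1 - (r - p) * ω 2) / (p + r) := by
    rw [dot3, a0, a1, a2]
    field_simp
    ring
  have hω' : ω 0 ^ 2 + ω 1 ^ 2 + ω 2 ^ 2 = 1 := by
    rw [← hω, norm3sq, dot3]; ring
  rw [hn, hdot, hM]
  by_cases h1 : ω 2 = 1
  · have e0 : ω 0 = 0 := by rw [h1] at hω'; nlinarith [sq_nonneg (ω 0), sq_nonneg (ω 1)]
    have e1 : ω 1 = 0 := by rw [h1] at hω'; nlinarith [sq_nonneg (ω 0), sq_nonneg (ω 1)]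
    rw [jacA, if_pos h1, ← hpe, Real.sqrt_sq (by positivity), e0, e1, h1]
    have : p + r + 2 * q1 * 0 + 2 * q2 * 0 - (r - p) * 1 = 2 * p := by ring
    rw [this]
    field_simp
    try norm_num
  · have hne : 1 - ω 2 ≠ 0 := fun h => h1 (by linarith)
    have hs : 1 + sq2 (SP ω) = 2 / (1 - ω 2) := by
      simp only [sq2, SP]
      field_simp
      linear_combination hω'
    have h0 := sq2_nonneg' (SP ω)
    have hq := hQpos (SP ω)
    rw [jacA, if_neg h1, hcx, hQ, Real.sqrt_sq (by positivity)]
    have hD : p + r + 2 * q1 * ω 0 + 2 * q2 * ω 1 - (r - p) * ω 2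
        = (1 - ω 2) * (p * sq2 (SP ω) + 2 * q1 * (SP ω).1 + 2 * q2 * (SP ω).2 + r) := by
      have : sq2 (SP ω) = 2 / (1 - ω 2) - 1 := by linarith
      rw [this]
      simp only [SP]
      field_simp
      ring
    rw [hD, hs]
    field_simp
    try norm_num

end main
end

section
/- Let τ be a conformal transformation of 𝕊² with center of mass a = a_τ, and let w: ℝ² → ℝ be defined by w(x) = ψ_τ(𝒮⁻¹(x)). Then w is smooth and satisfies, for every x ∈ ℝ², the Euler–Lagrange equation in stereographic form: (2/3)·((1+|x|²)²/4)·Δw(x) + ((1 − a·𝒮⁻¹(x))/(1 − |a|²))·e^{2w(x)} − 1 = 0, where Δ is the Euclidean Laplacian on ℝ² (this is the stereographic expression of (2/3)Δ_{𝕊²}ψ_τ + ((1−a·ω)/(1−|a|²))e^{2ψ_τ} − 1 = 0 on 𝕊²). -/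
open MeasureTheory
open scoped Classical

/-- The Euclidean Laplacian of `w : ℝ² → ℝ`. -/
noncomputable def lap2 (w : ℝ × ℝ → ℝ) (x : ℝ × ℝ) : ℝ :=
  fderiv ℝ (fun y => fderiv ℝ w y (1, 0)) x (1, 0) +
    fderiv ℝ (fun y => fderiv ℝ w y (0, 1)) x (0, 1)


theorem el_int2 : Integrable (fun u : ℝ × ℝ => ((1 + sq2 u) ^ 2)⁻¹) := by
  have h := (integrable_inv_one_add_sq).mul_prod (integrable_inv_one_add_sq)
  refine Integrable.mono' h ?_ ?_
  · refine Continuous.aestronglyMeasurable ?_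
    have : ∀ u : ℝ × ℝ, (1 + (u.1 ^ 2 + u.2 ^ 2)) ^ 2 ≠ 0 := fun u => by positivity
    unfold sq2
    fun_prop (disch := assumption)
  · refine Filter.Eventually.of_forall fun u => ?_
    unfold sq2
    rw [Real.norm_of_nonneg (by positivity), ← mul_inv]
    apply inv_anti₀ (by positivity)
    nlinarith [sq_nonneg u.1, sq_nonneg u.2, mul_nonneg (sq_nonneg u.1) (sq_nonneg u.2),
      sq_nonneg (u.1 ^ 2), sq_nonneg (u.2 ^ 2)]

theorem el_int_of_bound (N : ℝ × ℝ → ℝ) (hN : Continuous N)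
    (hb : ∀ u, |N u| ≤ 1 + sq2 u) :
    Integrable (fun u : ℝ × ℝ => N u / (1 + sq2 u) ^ 3) := by
  refine Integrable.mono' el_int2 ?_ ?_
  · refine Continuous.aestronglyMeasurable ?_
    have : ∀ u : ℝ × ℝ, (1 + (u.1 ^ 2 + u.2 ^ 2)) ^ 3 ≠ 0 := fun u => by positivity
    unfold sq2
    fun_prop (disch := assumption)
  · refine Filter.Eventually.of_forall fun u => ?_
    have hp : 0 < 1 + sq2 u := by unfold sq2; positivity
    rw [Real.norm_eq_abs, abs_div, abs_of_pos (pow_pos hp 3), div_le_iff₀ (pow_pos hp 3)]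
    have : ((1 + sq2 u) ^ 2)⁻¹ * (1 + sq2 u) ^ 3 = 1 + sq2 u := by field_simp
    rw [this]; exact hb u

theorem el_polar (F : ℝ → ℝ) (I : ℝ) (hF : ∫ r in Set.Ioi (0:ℝ), r * F (r ^ 2) = I) :
    ∫ u : ℝ × ℝ, F (sq2 u) = 2 * Real.pi * I := by
  rw [← integral_comp_polarCoord_symm]
  have h1 : ∀ p : ℝ × ℝ, p.1 • F (sq2 (polarCoord.symm p))
      = (fun r : ℝ => r * F (r ^ 2)) p.1 * (fun _ : ℝ => (1:ℝ)) p.2 := by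
    intro p
    have : sq2 (polarCoord.symm p) = p.1 ^ 2 := by
      simp only [polarCoord_symm_apply, sq2]
      nlinarith [Real.sin_sq_add_cos_sq p.2]
    show p.1 * _ = _
    rw [this, mul_one]
  simp_rw [h1]
  rw [polarCoord_target, Measure.volume_eq_prod,
    setIntegral_prod_mul (fun r : ℝ => r * F (r ^ 2)) (fun _ : ℝ => (1:ℝ)), hF]
  simp
  rw [max_eq_left (by positivity)]
  ring

theorem el_rad0 : ∫ r in Set.Ioi (0:ℝ), r * (1 / (1 + r ^ 2) ^ 3) = 1 / 4 := by
  have hd : ∀ x ∈ Set.Ici (0:ℝ), HasDerivAt (fun r : ℝ => -(1/4) * ((1 + r ^ 2)^2)⁻¹)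
      (x * (1 / (1 + x ^ 2) ^ 3)) x := by
    intro x _
    have h0 : (1 + x ^ 2) ≠ 0 := by positivity
    have h := (((((hasDerivAt_id x).pow 2).const_add 1).pow 2).inv (by simpa using h0)).const_mul
      (-(1/4) : ℝ)
    refine HasDerivAt.congr_deriv h ?_
    simp
    field_simp
    try ring
  have hp : ∀ x ∈ Set.Ioi (0:ℝ), 0 ≤ x * (1 / (1 + x ^ 2) ^ 3) := by
    intro x hx
    have : (0:ℝ) < x := hx
    positivity
  have ht : Filter.Tendsto (fun r : ℝ => -(1/4) * ((1 + r ^ 2)^2)⁻¹) Filter.atTop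
      (nhds (-(1/4) * 0)) := by
    apply Filter.Tendsto.const_mul
    apply Filter.Tendsto.inv_tendsto_atTop
    apply Filter.tendsto_atTop_mono (f := fun r : ℝ => r) _ Filter.tendsto_id
    intro r
    nlinarith [sq_nonneg (r - 1), sq_nonneg (r ^ 2), sq_nonneg r]
  rw [integral_Ioi_of_hasDerivAt_of_nonneg' hd hp ht]
  norm_num

theorem el_rad1 : ∫ r in Set.Ioi (0:ℝ), r * (r ^ 2 / (1 + r ^ 2) ^ 3) = 1 / 4 := by
  have hd : ∀ x ∈ Set.Ici (0:ℝ), HasDerivAt (fun r : ℝ => (1/4) * (1 - (1 + r ^ 2)⁻¹) ^ 2)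
      (x * (x ^ 2 / (1 + x ^ 2) ^ 3)) x := by
    intro x _
    have h0 : (1 + x ^ 2) ≠ 0 := by positivity
    have h := ((((((hasDerivAt_id x).pow 2).const_add 1).inv (by simpa using h0)).const_sub 1).pow
      2).const_mul (1/4 : ℝ)
    refine HasDerivAt.congr_deriv h ?_
    simp
    field_simp
    try ring
  have hp : ∀ x ∈ Set.Ioi (0:ℝ), 0 ≤ x * (x ^ 2 / (1 + x ^ 2) ^ 3) := by
    intro x hx
    have : (0:ℝ) < x := hx
    positivity
  have ht : Filter.Tendsto (fun r : ℝ => (1/4) * (1 - (1 + r ^ 2)⁻¹) ^ 2) Filter.atTop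
      (nhds ((1/4) * (1 - 0) ^ 2)) := by
    apply Filter.Tendsto.const_mul
    apply Filter.Tendsto.pow
    apply Filter.Tendsto.const_sub
    apply Filter.Tendsto.inv_tendsto_atTop
    apply Filter.tendsto_atTop_mono (f := fun r : ℝ => r) _ Filter.tendsto_id
    intro r
    nlinarith [sq_nonneg (r - 1), sq_nonneg r]
  rw [integral_Ioi_of_hasDerivAt_of_nonneg' hd hp ht]
  norm_num

theorem el_odd (G : ℝ × ℝ → ℝ) (h : ∀ u, G (-u) = - G u) : ∫ u, G u = 0 := by
  have h1 : ∫ u, G (-u) = ∫ u, G u := integral_neg_eq_self G volume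
  simp_rw [h, integral_neg] at h1
  linarith

theorem el_base (α β γ δ : ℝ) :
    Integrable (fun u : ℝ × ℝ => (α + β * u.1 + γ * u.2 + δ * sq2 u) / (1 + sq2 u) ^ 3) ∧
    ∫ u : ℝ × ℝ, (α + β * u.1 + γ * u.2 + δ * sq2 u) / (1 + sq2 u) ^ 3
      = (α + δ) * (Real.pi / 2) := by
  have i0 := el_int_of_bound (fun _ => 1) (by fun_prop)
    (fun u => by simp; unfold sq2; positivity)
  have i1 := el_int_of_bound (fun u => u.1) (by fun_prop)
    (fun u => by unfold sq2; rw [abs_le]; constructor <;>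
                  nlinarith [sq_nonneg (u.1 - 1), sq_nonneg (u.1 + 1), sq_nonneg u.2])
  have i2 := el_int_of_bound (fun u => u.2) (by fun_prop)
    (fun u => by unfold sq2; rw [abs_le]; constructor <;>
                  nlinarith [sq_nonneg (u.2 - 1), sq_nonneg (u.2 + 1), sq_nonneg u.1])
  have i3 := el_int_of_bound (fun u => sq2 u) (by unfold sq2; fun_prop)
    (fun u => by rw [abs_of_nonneg (by unfold sq2; positivity)]; linarith)
  have e : (fun u : ℝ × ℝ => (α + β * u.1 + γ * u.2 + δ * sq2 u) / (1 + sq2 u) ^ 3)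
      = fun u => ((α * (1 / (1 + sq2 u) ^ 3) + β * (u.1 / (1 + sq2 u) ^ 3))
        + γ * (u.2 / (1 + sq2 u) ^ 3)) + δ * (sq2 u / (1 + sq2 u) ^ 3) := by
    funext u; ring
  have v0 : ∫ u : ℝ × ℝ, 1 / (1 + sq2 u) ^ 3 = Real.pi / 2 := by
    rw [el_polar (fun s => 1 / (1 + s) ^ 3) _ el_rad0]; ring
  have v3 : ∫ u : ℝ × ℝ, sq2 u / (1 + sq2 u) ^ 3 = Real.pi / 2 := by
    rw [el_polar (fun s => s / (1 + s) ^ 3) _ el_rad1]; ring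
  have v1 : ∫ u : ℝ × ℝ, u.1 / (1 + sq2 u) ^ 3 = 0 :=
    el_odd _ fun u => by simp [sq2, neg_div]
  have v2 : ∫ u : ℝ × ℝ, u.2 / (1 + sq2 u) ^ 3 = 0 :=
    el_odd _ fun u => by simp [sq2, neg_div]
  rw [e]
  have j1 := (i0.const_mul α).fun_add (i1.const_mul β)
  have j2 := j1.fun_add (i2.const_mul γ)
  refine ⟨j2.fun_add (i3.const_mul δ), ?_⟩
  rw [integral_add j2 (i3.const_mul δ), integral_add j1 (i2.const_mul γ),
    integral_add (i0.const_mul α) (i1.const_mul β)]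
  simp only [integral_const_mul, v0, v1, v2, v3]
  ring

theorem el_shift (P : ℝ) (hP : 0 < P) (q : ℝ × ℝ) (G : ℝ × ℝ → ℝ) (hG : Integrable G) :
    Integrable (fun x => G (P • x + q)) ∧ ∫ x, G (P • x + q) = (P ^ 2)⁻¹ * ∫ u, G u := by
  have hK : Integrable (fun y => G (y + q)) := hG.comp_add_right q
  refine ⟨hK.comp_smul hP.ne', ?_⟩
  have := Measure.integral_comp_smul (volume : Measure (ℝ × ℝ)) (fun y => G (y + q)) P
  rw [this, integral_add_right_eq_self (μ := (volume : Measure (ℝ × ℝ))) G q]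
  simp

theorem el_quad (P R q1 q2 : ℝ) (hP : 0 < P) (hPR : P * R = 1 + q1 ^ 2 + q2 ^ 2)
    (c0 c1 c2 c3 : ℝ) :
    Integrable (fun x : ℝ × ℝ => (c0 + c1 * x.1 + c2 * x.2 + c3 * sq2 x) /
      (P * sq2 x + 2 * q1 * x.1 + 2 * q2 * x.2 + R) ^ 3) ∧
    ∫ x : ℝ × ℝ, (c0 + c1 * x.1 + c2 * x.2 + c3 * sq2 x) /
      (P * sq2 x + 2 * q1 * x.1 + 2 * q2 * x.2 + R) ^ 3
      = (c0 * P - c1 * q1 - c2 * q2 + c3 * R) * (Real.pi / 2) := by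
  obtain ⟨hi, hv⟩ := el_base
    (P ^ 3 * (c0 - (c1 * q1 + c2 * q2) / P + c3 * (q1 ^ 2 + q2 ^ 2) / P ^ 2))
    (P ^ 3 * (c1 / P - 2 * c3 * q1 / P ^ 2)) (P ^ 3 * (c2 / P - 2 * c3 * q2 / P ^ 2))
    (P ^ 3 * (c3 / P ^ 2))
  obtain ⟨hi', hv'⟩ := el_shift P hP (q1, q2) _ hi
  have hR : R = (1 + q1 ^ 2 + q2 ^ 2) / P := by field_simp; linarith
  have e : ∀ x : ℝ × ℝ, (c0 + c1 * x.1 + c2 * x.2 + c3 * sq2 x) /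
      (P * sq2 x + 2 * q1 * x.1 + 2 * q2 * x.2 + R) ^ 3 =
      (fun u : ℝ × ℝ =>
      (P ^ 3 * (c0 - (c1 * q1 + c2 * q2) / P + c3 * (q1 ^ 2 + q2 ^ 2) / P ^ 2)
      + (P ^ 3 * (c1 / P - 2 * c3 * q1 / P ^ 2)) * u.1 +
      (P ^ 3 * (c2 / P - 2 * c3 * q2 / P ^ 2)) * u.2 + (P ^ 3 * (c3 / P ^ 2)) * sq2 u)
      / (1 + sq2 u) ^ 3) (P • x + (q1, q2)) := by
    intro x
    have hden : 1 + sq2 (P • x + (q1, q2))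
        = P * (P * sq2 x + 2 * q1 * x.1 + 2 * q2 * x.2 + R) := by
      simp [sq2]; linear_combination -hPR
    have hnum : (P ^ 3 * (c0 - (c1 * q1 + c2 * q2) / P + c3 * (q1 ^ 2 + q2 ^ 2) / P ^ 2)
      + (P ^ 3 * (c1 / P - 2 * c3 * q1 / P ^ 2)) * (P • x + (q1, q2)).1 +
      (P ^ 3 * (c2 / P - 2 * c3 * q2 / P ^ 2)) * (P • x + (q1, q2)).2
      + (P ^ 3 * (c3 / P ^ 2)) * sq2 (P • x + (q1, q2)))
      = P ^ 3 * (c0 + c1 * x.1 + c2 * x.2 + c3 * sq2 x) := by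
      simp [sq2]; field_simp; ring
    show _ = _ / _
    rw [hnum, hden, mul_pow, mul_div_mul_left _ _ (by positivity)]
  simp_rw [e]
  refine ⟨hi', ?_⟩
  rw [hv', hv, hR]
  field_simp
  ring

theorem el_jac (A : SL2C) : ∃ P R q1 q2 : ℝ, 0 < P ∧ P * R = 1 + q1 ^ 2 + q2 ^ 2 ∧
    ∀ x, jacA A (SPinv x) =
      ((1 + sq2 x) / (P * sq2 x + 2 * q1 * x.1 + 2 * q2 * x.2 + R)) ^ 2 := by
  have hdet := A.2
  rw [Matrix.det_fin_two] at hdet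
  set a := A.1 0 0 with ha
  set b := A.1 0 1 with hb
  set c := A.1 1 0 with hc
  set d := A.1 1 1 with hd
  have hre := congrArg Complex.re hdet
  have him := congrArg Complex.im hdet
  simp at hre him
  refine ⟨Complex.normSq a + Complex.normSq c, Complex.normSq b + Complex.normSq d,
    a.re * b.re + a.im * b.im + c.re * d.re + c.im * d.im,
    a.re * b.im - a.im * b.re + c.re * d.im - c.im * d.re, ?_, ?_, ?_⟩
  · rcases eq_or_ne a 0 with h | h
    · have : c ≠ 0 := by
        intro h2; rw [h, h2] at hdet; simp at hdet
      have := Complex.normSq_pos.2 this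
      have := Complex.normSq_nonneg a
      linarith
    · have := Complex.normSq_pos.2 h
      have := Complex.normSq_nonneg c
      linarith
  · simp only [Complex.normSq_apply]
    have h1 : (a.re * d.re - a.im * d.im - (b.re * c.re - b.im * c.im)) ^ 2
      + (a.re * d.im + a.im * d.re - (b.re * c.im + b.im * c.re)) ^ 2 = 1 := by
      rw [hre, him]; norm_num
    linear_combination h1
  · intro x
    have hs : 0 < 1 + sq2 x := by unfold sq2; positivity
    have h2 : SPinv x 2 = (sq2 x - 1) / (1 + sq2 x) := rfl
    have h3 : 1 - SPinv x 2 = 2 / (1 + sq2 x) := by rw [h2]; field_simp; ring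
    have hne : SPinv x 2 ≠ 1 := by
      intro h; rw [h] at h3
      have : 0 < 2 / (1 + sq2 x) := by positivity
      linarith
    have hSP : SP (SPinv x) = x := by
      unfold SP
      rw [h3]
      have e0 : SPinv x 0 = 2 * x.1 / (1 + sq2 x) := rfl
      have e1 : SPinv x 1 = 2 * x.2 / (1 + sq2 x) := rfl
      rw [e0, e1]
      ext <;> simp <;> field_simp
    unfold jacA
    rw [if_neg hne, hSP, ← ha, ← hb, ← hc, ← hd]
    congr 2
    · simp [cx, Complex.normSq_apply, sq2]; ring
    · simp [cx, Complex.normSq_apply, sq2]; ring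

theorem el_fd (P R q1 q2 : ℝ) (x : ℝ × ℝ) :
    HasFDerivAt (fun y : ℝ × ℝ => P * sq2 y + 2 * q1 * y.1 + 2 * q2 * y.2 + R)
      ((2 * P * x.1 + 2 * q1) • ContinuousLinearMap.fst ℝ ℝ ℝ +
       (2 * P * x.2 + 2 * q2) • ContinuousLinearMap.snd ℝ ℝ ℝ) x := by
  unfold sq2
  have f1 : HasFDerivAt (fun y : ℝ × ℝ => y.1) (ContinuousLinearMap.fst ℝ ℝ ℝ) x := hasFDerivAt_fst
  have f2 : HasFDerivAt (fun y : ℝ × ℝ => y.2) (ContinuousLinearMap.snd ℝ ℝ ℝ) x := hasFDerivAt_snd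
  have := (((((f1.pow 2).add (f2.pow 2)).const_mul P).add (f1.const_mul (2 * q1))).add
    (f2.const_mul (2 * q2))).add_const R
  refine HasFDerivAt.congr_fderiv this ?_
  ext <;> simp <;> ring

theorem el_d1 (P R q1 q2 : ℝ) (x : ℝ × ℝ)
    (h0 : 0 < P * sq2 x + 2 * q1 * x.1 + 2 * q2 * x.2 + R) :
    HasFDerivAt (fun y : ℝ × ℝ => Real.log (P * sq2 y + 2 * q1 * y.1 + 2 * q2 * y.2 + R))
      ((P * sq2 x + 2 * q1 * x.1 + 2 * q2 * x.2 + R)⁻¹ •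
      ((2 * P * x.1 + 2 * q1) • ContinuousLinearMap.fst ℝ ℝ ℝ +
       (2 * P * x.2 + 2 * q2) • ContinuousLinearMap.snd ℝ ℝ ℝ)) x :=
  (el_fd P R q1 q2 x).log h0.ne'

theorem el_d2 (P R q1 q2 e1 e2 e3 : ℝ) (x : ℝ × ℝ)
    (h0 : 0 < P * sq2 x + 2 * q1 * x.1 + 2 * q2 * x.2 + R) :
    HasFDerivAt (fun y : ℝ × ℝ => (e1 * y.1 + e2 * y.2 + e3)
        * (P * sq2 y + 2 * q1 * y.1 + 2 * q2 * y.2 + R)⁻¹)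
      ((e1 * x.1 + e2 * x.2 + e3) •
        (-((P * sq2 x + 2 * q1 * x.1 + 2 * q2 * x.2 + R) ^ 2)⁻¹ •
      ((2 * P * x.1 + 2 * q1) • ContinuousLinearMap.fst ℝ ℝ ℝ +
       (2 * P * x.2 + 2 * q2) • ContinuousLinearMap.snd ℝ ℝ ℝ)) +
       (P * sq2 x + 2 * q1 * x.1 + 2 * q2 * x.2 + R)⁻¹ •
        (e1 • ContinuousLinearMap.fst ℝ ℝ ℝ + e2 • ContinuousLinearMap.snd ℝ ℝ ℝ)) x := by
  have f1 : HasFDerivAt (fun y : ℝ × ℝ => y.1) (ContinuousLinearMap.fst ℝ ℝ ℝ) x := hasFDerivAt_fst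
  have f2 : HasFDerivAt (fun y : ℝ × ℝ => y.2) (ContinuousLinearMap.snd ℝ ℝ ℝ) x := hasFDerivAt_snd
  have hi := (hasDerivAt_inv h0.ne').comp_hasFDerivAt x (el_fd P R q1 q2 x)
  exact (((f1.const_mul e1).add (f2.const_mul e2)).add_const e3).mul hi

theorem el_lap (P R q1 q2 k : ℝ) (hPR : P * R = 1 + q1 ^ 2 + q2 ^ 2)
    (h0 : ∀ x, 0 < P * sq2 x + 2 * q1 * x.1 + 2 * q2 * x.2 + R) (x : ℝ × ℝ) :
    lap2 (fun y => (3 / 2) * (Real.log (1 + sq2 y) -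
      Real.log (P * sq2 y + 2 * q1 * y.1 + 2 * q2 * y.2 + R)) + k) x
     = 6 * (1 / (1 + sq2 x) ^ 2 - 1 / (P * sq2 x + 2 * q1 * x.1 + 2 * q2 * x.2 + R) ^ 2) := by
  have hg : ∀ y, 1 + sq2 y = 1 * sq2 y + 2 * 0 * y.1 + 2 * 0 * y.2 + 1 := fun y => by ring
  have g0 : ∀ x, 0 < 1 * sq2 x + 2 * 0 * x.1 + 2 * 0 * x.2 + 1 := fun y => by
    rw [← hg]; unfold sq2; positivity
  have hF : ∀ y, HasFDerivAt (fun y => (3 / 2) * (Real.log (1 + sq2 y) -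
      Real.log (P * sq2 y + 2 * q1 * y.1 + 2 * q2 * y.2 + R)) + k) _ y := fun y => by
    simp_rw [hg]
    exact (((el_d1 1 1 0 0 y (g0 y)).sub (el_d1 P R q1 q2 y (h0 y))).const_mul (3/2)).add_const k
  unfold lap2
  have hx1 : (fun y => fderiv ℝ (fun y => (3 / 2) * (Real.log (1 + sq2 y) -
      Real.log (P * sq2 y + 2 * q1 * y.1 + 2 * q2 * y.2 + R)) + k) y (1, 0)) =
      fun y => (3 / 2) * ((2 * y.1 + 0 * y.2 + 0) * (1 * sq2 y + 2 * 0 * y.1 + 2 * 0 * y.2 + 1)⁻¹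
        - (2 * P * y.1 + 0 * y.2 + 2 * q1) *
          (P * sq2 y + 2 * q1 * y.1 + 2 * q2 * y.2 + R)⁻¹) := by
    funext y
    rw [(hF y).fderiv]
    simp
    ring
  have hx2 : (fun y => fderiv ℝ (fun y => (3 / 2) * (Real.log (1 + sq2 y) -
      Real.log (P * sq2 y + 2 * q1 * y.1 + 2 * q2 * y.2 + R)) + k) y (0, 1)) =
      fun y => (3 / 2) * ((0 * y.1 + 2 * y.2 + 0) * (1 * sq2 y + 2 * 0 * y.1 + 2 * 0 * y.2 + 1)⁻¹
        - (0 * y.1 + 2 * P * y.2 + 2 * q2) *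
          (P * sq2 y + 2 * q1 * y.1 + 2 * q2 * y.2 + R)⁻¹) := by
    funext y
    rw [(hF y).fderiv]
    simp
    ring
  rw [hx1, hx2,
    (((el_d2 1 1 0 0 2 0 0 x (g0 x)).fun_sub
      (el_d2 P R q1 q2 (2 * P) 0 (2 * q1) x (h0 x))).const_mul (3/2)).fderiv,
    (((el_d2 1 1 0 0 0 2 0 x (g0 x)).fun_sub
      (el_d2 P R q1 q2 0 (2 * P) (2 * q2) x (h0 x))).const_mul (3/2)).fderiv]
  have hh := (h0 x).ne'
  have hgx : 1 + sq2 x ≠ 0 := by rw [hg]; exact (g0 x).ne'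
  simp only [← hg]
  generalize hH : P * sq2 x + 2 * q1 * x.1 + 2 * q2 * x.2 + R = H at *
  generalize hS : 1 + sq2 x = S at *
  simp
  have k1 : (2 * P * x.1 + 2 * q1) ^ 2 + (2 * P * x.2 + 2 * q2) ^ 2 = 4 * P * H - 4 := by
    rw [← hH]; unfold sq2; linear_combination (-4) * hPR
  have k2 : x.1 ^ 2 + x.2 ^ 2 = S - 1 := by rw [← hS]; unfold sq2; ring
  field_simp
  linear_combination (-6) * H ^ 2 * k2 + (3 / 2) * S ^ 2 * k1

theorem el_coords (A : SL2C) (P R q1 q2 : ℝ) (hP : 0 < P) (hPR : P * R = 1 + q1 ^ 2 + q2 ^ 2)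
    (h0 : ∀ x : ℝ × ℝ, 0 < P * sq2 x + 2 * q1 * x.1 + 2 * q2 * x.2 + R)
    (hJ : ∀ x, jacA A (SPinv x) =
      ((1 + sq2 x) / (P * sq2 x + 2 * q1 * x.1 + 2 * q2 * x.2 + R)) ^ 2) :
    massA A = (P + R) / 2 ∧ comA A 0 = -(2 * q1) / (P + R) ∧ comA A 1 = -(2 * q2) / (P + R) ∧
      comA A 2 = (R - P) / (P + R) := by
  have hR : 0 < R := by
    by_contra h
    nlinarith [sq_nonneg q1, sq_nonneg q2, mul_nonneg hP.le (sub_nonneg.2 (not_lt.1 h))]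
  have hpi := Real.pi_pos
  have hpow : ∀ x, jacA A (SPinv x) ^ (3 / 2 : ℝ) =
      ((1 + sq2 x) / (P * sq2 x + 2 * q1 * x.1 + 2 * q2 * x.2 + R)) ^ 3 := by
    intro x
    have hs : 0 < 1 + sq2 x := by unfold sq2; positivity
    have hh := h0 x
    rw [hJ, ← Real.rpow_natCast _ 2, ← Real.rpow_mul (by positivity), ← Real.rpow_natCast _ 3]
    norm_num
  have key : ∀ x (c : ℝ), ((1 + sq2 x)⁻¹) ^ 2 * (jacA A (SPinv x) ^ (3 / 2 : ℝ) *
      (c / (1 + sq2 x))) = c / (P * sq2 x + 2 * q1 * x.1 + 2 * q2 * x.2 + R) ^ 3 := by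
    intro x c
    have hs : 0 < 1 + sq2 x := by unfold sq2; positivity
    have hh := h0 x
    rw [hpow]; field_simp
  have hM : massA A = (P + R) / 2 := by
    unfold massA sphInt
    have e : ∀ x : ℝ × ℝ, ((1 + sq2 x)⁻¹) ^ 2 • (jacA A (SPinv x) ^ (3 / 2 : ℝ)) =
        (1 + 0 * x.1 + 0 * x.2 + 1 * sq2 x) /
          (P * sq2 x + 2 * q1 * x.1 + 2 * q2 * x.2 + R) ^ 3 := by
      intro x
      have hs : 0 < 1 + sq2 x := by unfold sq2; positivity
      rw [← key, smul_eq_mul]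
      have : (1 + 0 * x.1 + 0 * x.2 + 1 * sq2 x) / (1 + sq2 x) = 1 := by
        rw [div_eq_one_iff_eq hs.ne']; ring
      rw [this, mul_one]
    simp_rw [e]
    rw [(el_quad P R q1 q2 hP hPR 1 0 0 1).2, smul_eq_mul]
    field_simp; ring
  have e0 : ∀ x : ℝ × ℝ, (((1 + sq2 x)⁻¹) ^ 2 • (jacA A (SPinv x) ^ (3 / 2 : ℝ) • SPinv x)) 0 =
        (0 + 2 * x.1 + 0 * x.2 + 0 * sq2 x) /
          (P * sq2 x + 2 * q1 * x.1 + 2 * q2 * x.2 + R) ^ 3 := by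
    intro x
    rw [← key, Pi.smul_apply, Pi.smul_apply, smul_eq_mul, smul_eq_mul]
    have : SPinv x 0 = 2 * x.1 / (1 + sq2 x) := rfl
    rw [this]; ring
  have e1 : ∀ x : ℝ × ℝ, (((1 + sq2 x)⁻¹) ^ 2 • (jacA A (SPinv x) ^ (3 / 2 : ℝ) • SPinv x)) 1 =
        (0 + 0 * x.1 + 2 * x.2 + 0 * sq2 x) /
          (P * sq2 x + 2 * q1 * x.1 + 2 * q2 * x.2 + R) ^ 3 := by
    intro x
    rw [← key, Pi.smul_apply, Pi.smul_apply, smul_eq_mul, smul_eq_mul]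
    have : SPinv x 1 = 2 * x.2 / (1 + sq2 x) := rfl
    rw [this]; ring
  have e2 : ∀ x : ℝ × ℝ, (((1 + sq2 x)⁻¹) ^ 2 • (jacA A (SPinv x) ^ (3 / 2 : ℝ) • SPinv x)) 2 =
        (-1 + 0 * x.1 + 0 * x.2 + 1 * sq2 x) /
          (P * sq2 x + 2 * q1 * x.1 + 2 * q2 * x.2 + R) ^ 3 := by
    intro x
    rw [← key, Pi.smul_apply, Pi.smul_apply, smul_eq_mul, smul_eq_mul]
    have : SPinv x 2 = (sq2 x - 1) / (1 + sq2 x) := rfl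
    rw [this]; ring
  have hint : ∀ i : Fin 3, Integrable (fun x : ℝ × ℝ =>
      (((1 + sq2 x)⁻¹) ^ 2 • (jacA A (SPinv x) ^ (3 / 2 : ℝ) • SPinv x)) i) := by
    intro i
    fin_cases i
    · exact (el_quad P R q1 q2 hP hPR 0 2 0 0).1.congr (Filter.Eventually.of_forall fun x => (e0 x).symm)
    · exact (el_quad P R q1 q2 hP hPR 0 0 2 0).1.congr (Filter.Eventually.of_forall fun x => (e1 x).symm)
    · exact (el_quad P R q1 q2 hP hPR (-1) 0 0 1).1.congr (Filter.Eventually.of_forall fun x => (e2 x).symm)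
  have hcom : ∀ i : Fin 3, comA A i = ((P + R) / 2)⁻¹ * ((1 / Real.pi) * ∫ x : ℝ × ℝ,
      (((1 + sq2 x)⁻¹) ^ 2 • (jacA A (SPinv x) ^ (3 / 2 : ℝ) • SPinv x)) i) := by
    intro i
    rw [← eval_integral hint i, ← hM]
    rfl
  refine ⟨hM, ?_, ?_, ?_⟩
  · rw [hcom]; simp_rw [e0]
    rw [(el_quad P R q1 q2 hP hPR 0 2 0 0).2]
    field_simp; ring
  · rw [hcom]; simp_rw [e1]
    rw [(el_quad P R q1 q2 hP hPR 0 0 2 0).2]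
    field_simp; ring
  · rw [hcom]; simp_rw [e2]
    rw [(el_quad P R q1 q2 hP hPR (-1) 0 0 1).2]
    field_simp; ring

/-- `w = ψ_τ ∘ 𝒮⁻¹` is smooth and satisfies the Euler–Lagrange equation
`(2/3)((1+|x|²)²/4)Δw + ((1 − a·𝒮⁻¹(x))/(1 − |a|²)) e^{2w} − 1 = 0` on `ℝ²`. -/
theorem euler_lagrange_equation (A : SL2C) :
    ContDiff ℝ (⊤ : ℕ∞) (fun x : ℝ × ℝ => psiA A (SPinv x)) ∧
    ∀ x : ℝ × ℝ,
      (2 / 3) * ((1 + sq2 x) ^ 2 / 4) * lap2 (fun y => psiA A (SPinv y)) x +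
          ((1 - dot3 (comA A) (SPinv x)) / (1 - norm3sq (comA A))) *
            Real.exp (2 * psiA A (SPinv x)) - 1 = 0 := by
  obtain ⟨P, R, q1, q2, hP, hPR, hJ⟩ := el_jac A
  have h0 : ∀ x : ℝ × ℝ, 0 < P * sq2 x + 2 * q1 * x.1 + 2 * q2 * x.2 + R := by
    intro x
    have h : P * (P * sq2 x + 2 * q1 * x.1 + 2 * q2 * x.2 + R)
        = (P * x.1 + q1) ^ 2 + (P * x.2 + q2) ^ 2 + 1 := by
      unfold sq2; linear_combination hPR
    have h' : 0 < P * (P * sq2 x + 2 * q1 * x.1 + 2 * q2 * x.2 + R) := by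
      rw [h]; positivity
    exact (mul_pos_iff_of_pos_left hP).1 h'
  have hR : 0 < R := by simpa [sq2] using h0 (0, 0)
  have g0 : ∀ x : ℝ × ℝ, 0 < 1 + sq2 x := fun x => by unfold sq2; positivity
  obtain ⟨hM, ha0, ha1, ha2⟩ := el_coords A P R q1 q2 hP hPR h0 hJ
  have hw : (fun x : ℝ × ℝ => psiA A (SPinv x)) = fun y => (3 / 2) * (Real.log (1 + sq2 y) -
      Real.log (P * sq2 y + 2 * q1 * y.1 + 2 * q2 * y.2 + R)) + cA A := by
    funext x
    unfold psiA
    rw [hJ, Real.log_pow, Real.log_div (g0 x).ne' (h0 x).ne']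
    push_cast; ring
  refine ⟨?_, fun x => ?_⟩
  · rw [hw]
    have c1 : ContDiff ℝ (⊤ : ℕ∞) (fun y : ℝ × ℝ => Real.log (1 + sq2 y)) := by
      refine ContDiff.log ?_ fun y => (g0 y).ne'
      unfold sq2; fun_prop
    have c2 : ContDiff ℝ (⊤ : ℕ∞) (fun y : ℝ × ℝ =>
        Real.log (P * sq2 y + 2 * q1 * y.1 + 2 * q2 * y.2 + R)) := by
      refine ContDiff.log ?_ fun y => (h0 y).ne'
      unfold sq2; fun_prop
    exact (contDiff_const.mul (c1.sub c2)).add contDiff_const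
  · have hexp : Real.exp (2 * psiA A (SPinv x)) =
        ((1 + sq2 x) / (P * sq2 x + 2 * q1 * x.1 + 2 * q2 * x.2 + R)) ^ 3 / ((P + R) / 2) := by
      have hx := congrFun hw x

      have hg := g0 x
      have hh := h0 x
      rw [hx, ← Real.log_div hg.ne' hh.ne', cA, hM]
      generalize ht : (1 + sq2 x) / (P * sq2 x + 2 * q1 * x.1 + 2 * q2 * x.2 + R) = t
      have htp : 0 < t := by rw [← ht]; positivity
      have : 2 * (3 / 2 * Real.log t + -(1 / 2) * Real.log ((P + R) / 2))
          = (3 : ℕ) * Real.log t - Real.log ((P + R) / 2) := by push_cast; ring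
      rw [this, Real.exp_sub, Real.exp_nat_mul, Real.exp_log htp, Real.exp_log (by positivity)]
    have hn : 1 - norm3sq (comA A) = 4 / (P + R) ^ 2 := by
      unfold norm3sq dot3
      rw [ha0, ha1, ha2]
      field_simp
      linear_combination 4 * hPR
    have hd : 1 - dot3 (comA A) (SPinv x) =
        2 * (P * sq2 x + 2 * q1 * x.1 + 2 * q2 * x.2 + R) / ((P + R) * (1 + sq2 x)) := by
      have s0 : SPinv x 0 = 2 * x.1 / (1 + sq2 x) := rfl
      have s1 : SPinv x 1 = 2 * x.2 / (1 + sq2 x) := rfl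
      have s2 : SPinv x 2 = (sq2 x - 1) / (1 + sq2 x) := rfl
      have hg := g0 x
      unfold dot3
      rw [ha0, ha1, ha2, s0, s1, s2]
      field_simp
      ring
    rw [hexp, hn, hd, hw, el_lap P R q1 q2 _ hPR h0 x]
    have hg := g0 x
    have hh := h0 x
    generalize P * sq2 x + 2 * q1 * x.1 + 2 * q2 * x.2 + R = H at *
    generalize 1 + sq2 x = S at *
    field_simp
    ring
end
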